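/- Let G be a unicyclic graph of order n ≥ 5 not isomorphic to the cycle C_n. Then S_k(G) ≤ S_k(U_n) for every k ≥ 1 (i.e., CS(G,x) ⪯ CS(U_n,x) coefficientwise). -/

import Mathlib

open SimpleGraph

/-- `S_k(G)`: the number of connected sets of `G` of cardinality `k`. -/
noncomputable def connCount {V : Type} (G : SimpleGraph V) (k : ℕ) : ℕ :=
  Nat.card {S : Finset V // S.card = k ∧ (G.induce (S : Set V)).Connected}

/-- `U_n = (K_2 ∪ K̄_{n−3}) ∨ K_1`: on `{0,…,n−1}`, vertex `0` is adjacent to every other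
vertex, vertices `1` and `2` are adjacent, and there are no other edges. -/
def Ugraph (n : ℕ) : SimpleGraph (Fin n) :=
  SimpleGraph.fromRel (fun a b => a.val = 0 ∨ (a.val = 1 ∧ b.val = 2))


section aux

open Finset Classical

/-- combinatorial connectedness of a vertex set -/
def Cn {V : Type} (G : SimpleGraph V) (S : Finset V) : Prop :=
  S.Nonempty ∧ ∀ T ⊆ S, T.Nonempty → (∀ x ∈ T, ∀ y ∈ S, G.Adj x y → y ∈ T) → T = S

/-- degree inside a vertex set -/
noncomputable def dg {V : Type} (G : SimpleGraph V) (A : Finset V) (x : V) : ℕ :=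
  (A.filter (G.Adj x)).card

/-- number of connected k-subsets of A -/
noncomputable def fc {V : Type} (G : SimpleGraph V) (A : Finset V) (k : ℕ) : ℕ :=
  ((A.powersetCard k).filter (Cn G)).card

lemma Cn_iff {V : Type} (G : SimpleGraph V) (S : Finset V) :
    (G.induce (S : Set V)).Connected ↔ Cn G S := by
  constructor
  · intro h
    refine ⟨?_, ?_⟩
    · obtain ⟨⟨x, hx⟩⟩ := h.nonempty
      exact ⟨x, hx⟩
    · intro T hT hne hcl
      obtain ⟨x, hx⟩ := hne
      apply Finset.Subset.antisymm hT
      intro y hy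
      obtain ⟨p⟩ := h.preconnected ⟨x, hT hx⟩ ⟨y, hy⟩
      have key : ∀ (a b : (S : Set V)), (G.induce (S : Set V)).Walk a b → a.1 ∈ T → b.1 ∈ T := by
        intro a b p
        induction p with
        | nil => exact id
        | cons hadj _ ih =>
          intro ha
          exact ih (hcl _ ha _ (Subtype.property _) hadj)
      exact key _ _ p hx
  · rintro ⟨⟨x, hx⟩, h⟩
    have hpre : ∀ y (hy : y ∈ S), (G.induce (S : Set V)).Reachable ⟨x, hx⟩ ⟨y, hy⟩ := by
      have := h (S.filter (fun y => ∃ hy : y ∈ S,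
        (G.induce (S : Set V)).Reachable ⟨x, hx⟩ ⟨y, hy⟩)) (Finset.filter_subset _ _)
        ⟨x, by simp [hx]⟩ (by
          intro a ha b hb hab
          simp only [Finset.mem_filter] at ha ⊢
          obtain ⟨ha, _, hr⟩ := ha
          refine ⟨hb, hb, hr.trans (SimpleGraph.Adj.reachable ?_)⟩
          exact hab)
      intro y hy
      rw [← this] at hy
      exact (Finset.mem_filter.1 hy).2.2
    have : Nonempty (S : Set V) := ⟨⟨x, hx⟩⟩
    refine ⟨?_⟩
    rintro ⟨a, ha⟩ ⟨b, hb⟩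
    exact (hpre a ha).symm.trans (hpre b hb)

lemma connCount_eq {V : Type} [Fintype V] (G : SimpleGraph V) (k : ℕ) :
    connCount G k = fc G Finset.univ k := by
  unfold connCount fc
  rw [Nat.subtype_card]
  intro S
  have := Cn_iff G S
  simp only [Finset.mem_filter, Finset.mem_powersetCard, Finset.subset_univ, true_and]
  rw [← this]

lemma Cn.exists_adj {V : Type} {G : SimpleGraph V} {S : Finset V} (h : Cn G S)
    {v : V} (hv : v ∈ S) (hc : 2 ≤ S.card) : ∃ w ∈ S, G.Adj v w := by
  by_contra hcon
  push Not at hcon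
  have := h.2 {v} (by simpa using hv) ⟨v, by simp⟩ (by
    intro x hx y hy hxy
    rw [Finset.mem_singleton] at hx; subst hx
    exact absurd hxy (hcon y hy))
  rw [← this] at hc
  simp at hc

lemma dg_one {V : Type} {G : SimpleGraph V} {A : Finset V} {v : V} (h : dg G A v = 1) :
    ∃ w ∈ A, G.Adj v w ∧ ∀ y ∈ A, G.Adj v y → y = w := by
  obtain ⟨w, hw⟩ := Finset.card_eq_one.1 h
  have hw' : w ∈ A.filter (G.Adj v) := by rw [hw]; simp
  rw [Finset.mem_filter] at hw'
  refine ⟨w, hw'.1, hw'.2, fun y hy hvy => ?_⟩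
  have : y ∈ A.filter (G.Adj v) := by simp [hy, hvy]
  rw [hw] at this; simpa using this

lemma Cn.erase_leaf {V : Type} {G : SimpleGraph V} {A : Finset V} (h : Cn G A) {v w : V}
    (hv : v ∈ A) (hw : w ∈ A) (hvw : G.Adj v w) (hu : ∀ y ∈ A, G.Adj v y → y = w) :
    Cn G (A.erase v) := by
  refine ⟨⟨w, by simp [hw, hvw.ne.symm]⟩, ?_⟩
  intro T hT hne hcl
  have hTA : T ⊆ A := hT.trans (Finset.erase_subset _ _)
  have hvT : v ∉ T := fun hh => by simpa using hT hh
  by_cases hwT : w ∈ T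
  · have := h.2 (insert v T) (by intro x hx; grind) ⟨v, by simp⟩ (by
      intro x hx y hy hxy
      by_cases hyv : y = v
      · simp [hyv]
      rcases Finset.mem_insert.1 hx with rfl | hx
      · rw [hu y hy hxy]; simp [hwT]
      · exact Finset.mem_insert_of_mem (hcl x hx y (by simp [hy, hyv]) hxy))
    rw [← this]; simp [hvT]
  · have := h.2 T hTA hne (by
      intro x hx y hy hxy
      by_cases hyv : y = v
      · subst hyv
        have := hu x (hTA hx) hxy.symm
        subst this; exact absurd hx hwT
      · exact hcl x hx y (by simp [hy, hyv]) hxy)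
    rw [this] at hvT; exact absurd hv hvT

lemma dg_two {V : Type} {G : SimpleGraph V} {A : Finset V} {v w u y : V} (h : dg G A v = 2)
    (hw : w ∈ A) (hvw : G.Adj v w) (hu : u ∈ A) (hvu : G.Adj v u) (hne : w ≠ u)
    (hy : y ∈ A) (hvy : G.Adj v y) : y = w ∨ y = u := by
  by_contra hcon
  push Not at hcon
  have : ({w, u, y} : Finset V) ⊆ A.filter (G.Adj v) := by
    intro z hz
    simp only [Finset.mem_insert, Finset.mem_singleton] at hz
    rcases hz with rfl | rfl | rfl <;> simp [*]
  have h2 := Finset.card_le_card this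
  unfold dg at h
  rw [h, Finset.card_eq_three.2 ⟨w, u, y, hne, hcon.1.symm, hcon.2.symm, rfl⟩] at h2
  omega

lemma dart_unique {V : Type} {G : SimpleGraph V} {H : Finset V} (hreg : ∀ x ∈ H, dg G H x = 2) :
    ∀ (k : ℕ) (u w : V) (S S' : Finset V), u ∈ S → u ∈ S' → w ∉ S → w ∉ S' → w ∈ H →
      G.Adj u w → Cn G S → Cn G S' → S ⊆ H → S' ⊆ H → S.card = k → S'.card = k → S = S' := by
  intro k
  induction k with
  | zero => intro u w S S' h1 _ _ _ _ _ _ _ _ _ h2; simp at h2; subst h2; simp at h1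
  | succ k ih =>
    intro u w S S' hu hu' hw hw' hwH hadj hc hc' hS hS' hk hk'
    by_cases hk0 : k = 0
    · subst hk0
      obtain ⟨a, rfl⟩ := Finset.card_eq_one.1 hk
      obtain ⟨b, rfl⟩ := Finset.card_eq_one.1 hk'
      simp at hu hu'; rw [← hu, ← hu']
    obtain ⟨y, hy, huy⟩ := hc.exists_adj hu (by omega)
    obtain ⟨y', hy', huy'⟩ := hc'.exists_adj hu' (by omega)
    have hyw : w ≠ y := fun h => hw (h ▸ hy)
    have hyw' : w ≠ y' := fun h => hw' (h ▸ hy')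
    have hr := hreg u (hS hu)
    have huniq : ∀ z ∈ H, G.Adj u z → z = w ∨ z = y := fun z hz huz =>
      dg_two hr hwH hadj (hS hy) huy hyw hz huz
    have : y' = y := (huniq y' (hS' hy') huy').resolve_left hyw'.symm
    subst this
    have e1 := hc.erase_leaf hu hy huy (fun z hz huz =>
      (huniq z (hS hz) huz).resolve_left (fun h => hw (h ▸ hz)))
    have e2 := hc'.erase_leaf hu' hy' huy (fun z hz huz =>
      (huniq z (hS' hz) huz).resolve_left (fun h => hw' (h ▸ hz)))
    have := ih y' u (S.erase u) (S'.erase u) (by simp [hy, huy.ne.symm])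
      (by simp [hy', huy.ne.symm]) (by simp) (by simp) (hS hu) huy.symm e1 e2
      ((Finset.erase_subset _ _).trans hS) ((Finset.erase_subset _ _).trans hS')
      (by rw [Finset.card_erase_of_mem hu]; omega) (by rw [Finset.card_erase_of_mem hu']; omega)
    rw [← Finset.insert_erase hu, this, Finset.insert_erase hu']

lemma even_inner {V : Type} (G : SimpleGraph V) (S : Finset V) :
    Even (((S ×ˢ S).filter (fun d => G.Adj d.1 d.2)).card) := by
  rw [← ZMod.natCast_eq_zero_iff_even, Finset.card_eq_sum_ones, Nat.cast_sum]
  refine Finset.sum_involution (fun d _ => (d.2, d.1)) ?_ ?_ ?_ ?_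
  · intro a _; simp; decide
  · rintro ⟨a, b⟩ h _ heq
    simp at h heq
    exact h.2.ne heq.2
  · rintro ⟨a, b⟩ h
    simp at h ⊢
    exact ⟨⟨h.1.2, h.1.1⟩, h.2.symm⟩
  · simp

lemma darts_card {V : Type} (G : SimpleGraph V) (S H : Finset V)
    (hreg : ∀ x ∈ S, dg G H x = 2) :
    ((S ×ˢ H).filter (fun d => G.Adj d.1 d.2)).card = 2 * S.card := by
  rw [Finset.card_filter, Finset.sum_product]
  have : ∀ x ∈ S, ∑ y ∈ H, (if G.Adj x y then 1 else 0) = 2 := by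
    intro x hx
    rw [← Finset.card_filter]; exact hreg x hx
  rw [Finset.sum_congr rfl this]; simp [mul_comm]

lemma two_darts {V : Type} {G : SimpleGraph V} {H S : Finset V} (hH : Cn G H)
    (hreg : ∀ x ∈ H, dg G H x = 2) (hS : S ⊆ H) (hne : S.Nonempty) (hlt : S.card < H.card) :
    2 ≤ ((S ×ˢ (H \ S)).filter (fun d => G.Adj d.1 d.2)).card := by
  have h1 := darts_card G S H (fun x hx => hreg x (hS hx))
  have h2 := even_inner G S
  have h3 : ((S ×ˢ H).filter (fun d => G.Adj d.1 d.2)).card =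
     ((S ×ˢ S).filter (fun d => G.Adj d.1 d.2)).card
      + ((S ×ˢ (H \ S)).filter (fun d => G.Adj d.1 d.2)).card := by
    rw [← Finset.card_union_of_disjoint]
    · congr 1
      ext ⟨a, b⟩
      simp only [Finset.mem_filter, Finset.mem_product, Finset.mem_union, Finset.mem_sdiff]
      have := @hS b
      tauto
    · rw [Finset.disjoint_left]
      rintro ⟨a, b⟩
      simp only [Finset.mem_filter, Finset.mem_product, Finset.mem_sdiff]
      tauto
  have h4 : 0 < ((S ×ˢ (H \ S)).filter (fun d => G.Adj d.1 d.2)).card := by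
    rw [Finset.card_pos]
    by_contra hcon
    rw [Finset.not_nonempty_iff_eq_empty] at hcon
    have := hH.2 S hS hne (by
      intro x hx y hy hxy
      by_contra hyS
      have : (x, y) ∈ ((S ×ˢ (H \ S)).filter (fun d => G.Adj d.1 d.2)) := by
        simp only [Finset.mem_filter, Finset.mem_product, Finset.mem_sdiff]
        exact ⟨⟨hx, hy, hyS⟩, hxy⟩
      rw [hcon] at this; simp at this)
    rw [this] at hlt; omega
  obtain ⟨r, hr⟩ := h2
  omega

lemma fc_cycle {V : Type} {G : SimpleGraph V} {H : Finset V} (hH : Cn G H)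
    (hreg : ∀ x ∈ H, dg G H x = 2) {k : ℕ} (hk : k < H.card) : fc G H k ≤ H.card := by
  have := Finset.card_mul_le_card_mul (m := 2) (n := 1)
    (s := (H.powersetCard k).filter (Cn G))
    (t := (H ×ˢ H).filter (fun d => G.Adj d.1 d.2))
    (fun S d => d.1 ∈ S ∧ d.2 ∉ S) ?_ ?_
  · rw [darts_card G H H hreg] at this
    unfold fc; omega
  · intro S hS
    simp only [Finset.mem_filter, Finset.mem_powersetCard] at hS
    obtain ⟨⟨hSH, hSk⟩, hc⟩ := hS
    refine (two_darts hH hreg hSH hc.1 (by omega)).trans (Finset.card_le_card ?_)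
    rintro ⟨a, b⟩
    simp only [Finset.mem_filter, Finset.mem_product, Finset.mem_sdiff,
      Finset.mem_bipartiteAbove]
    have := @hSH a
    tauto
  · rintro ⟨a, b⟩ hd
    simp only [Finset.mem_filter, Finset.mem_product] at hd
    rw [Finset.card_le_one]
    intro S hS S' hS'
    simp only [Finset.mem_filter, Finset.mem_powersetCard, Finset.mem_bipartiteBelow] at hS hS'
    exact dart_unique hreg k a b S S' hS.2.1 hS'.2.1 hS.2.2 hS'.2.2 hd.1.2 hd.2 hS.1.2 hS'.1.2
      hS.1.1.1 hS'.1.1.1 hS.1.1.2 hS'.1.1.2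

lemma choose_bound : ∀ (N j : ℕ), 2 ≤ j → j + 2 ≤ N → N + 1 ≤ N.choose j := by
  intro N
  induction N with
  | zero => intro j h1 h2; omega
  | succ N ih =>
    intro j h1 h2
    obtain ⟨j, rfl⟩ : ∃ i, j = i + 1 := ⟨j - 1, by omega⟩
    rw [Nat.choose_succ_succ']
    by_cases hN : N = 3
    · subst hN
      have : j = 1 := by omega
      subst this; decide
    by_cases hj : j + 1 + 2 ≤ N
    · have := ih (j + 1) h1 hj
      have : 0 < N.choose j := Nat.choose_pos (by omega)
      omega
    · have := ih j (by omega) (by omega)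
      have : 0 < N.choose (j + 1) := Nat.choose_pos (by omega)
      omega

lemma fc_le_choose {V : Type} (G : SimpleGraph V) (H : Finset V) (k : ℕ) :
    fc G H k ≤ H.card.choose k := by
  rw [← Finset.card_powersetCard]
  exact Finset.card_filter_le _ _

/-- connected k-subsets through a leaf -/
noncomputable def gc {V : Type} (G : SimpleGraph V) (A : Finset V) (v : V) (k : ℕ) : ℕ :=
  (((A.powersetCard k).filter (Cn G)).filter (fun S => v ∈ S)).card

lemma fc_split {V : Type} (G : SimpleGraph V) (A : Finset V) (v : V) (k : ℕ) :
    fc G A k = gc G A v k + fc G (A.erase v) k := by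
  unfold fc gc
  rw [← Finset.card_filter_add_card_filter_not (s := (A.powersetCard k).filter (Cn G))
    (fun S => v ∈ S)]
  congr 2
  ext S
  simp only [Finset.mem_filter, Finset.mem_powersetCard, Finset.subset_erase]
  tauto

lemma gc_maps {V : Type} {G : SimpleGraph V} {A : Finset V} {v w : V} {k : ℕ} (hk : 3 ≤ k)
    (hvw : G.Adj v w) (hu : ∀ y ∈ A, G.Adj v y → y = w) {S : Finset V}
    (hS : S ∈ ((A.powersetCard k).filter (Cn G)).filter (fun S => v ∈ S)) :
    S ⊆ A ∧ S.card = k ∧ Cn G S ∧ v ∈ S ∧ w ∈ S ∧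
    (S.erase v).erase w ∈ ((A.erase v).erase w).powersetCard (k - 2) := by
  simp only [Finset.mem_filter, Finset.mem_powersetCard] at hS
  obtain ⟨⟨⟨hSA, hSk⟩, hc⟩, hv⟩ := hS
  obtain ⟨y, hy, hvy⟩ := hc.exists_adj hv (by omega)
  have := hu y (hSA hy) hvy
  subst this
  refine ⟨hSA, hSk, hc, hv, hy, ?_⟩
  rw [Finset.mem_powersetCard]
  refine ⟨Finset.erase_subset_erase _ (Finset.erase_subset_erase _ hSA), ?_⟩
  rw [Finset.card_erase_of_mem (by simp [hy, hvw.ne.symm]), Finset.card_erase_of_mem hv]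
  omega

lemma ins_er {V : Type} {S : Finset V} {v w : V} (hv : v ∈ S) (hw : w ∈ S) (hne : v ≠ w) :
    insert v (insert w ((S.erase v).erase w)) = S := by
  rw [Finset.insert_erase (by simp [hw, hne.symm]), Finset.insert_erase hv]

lemma gc_le {V : Type} {G : SimpleGraph V} {A : Finset V} {v w : V} {k : ℕ} (hk : 3 ≤ k)
    (hv : v ∈ A) (hw : w ∈ A)
    (hvw : G.Adj v w) (hu : ∀ y ∈ A, G.Adj v y → y = w) :
    gc G A v k ≤ ((A.erase v).card - 1).choose (k - 2) := by
  rw [← Finset.card_erase_of_mem (show w ∈ A.erase v by simp [hw, hvw.ne.symm]),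
    ← Finset.card_powersetCard]
  apply Finset.card_le_card_of_injOn (fun S => (S.erase v).erase w)
  · intro S hS
    exact (gc_maps hk hvw hu hS).2.2.2.2.2
  · intro S hS S' hS' heq
    have h1 := gc_maps hk hvw hu hS
    have h2 := gc_maps hk hvw hu hS'
    simp only at heq
    rw [← ins_er h1.2.2.2.1 h1.2.2.2.2.1 hvw.ne, heq, ins_er h2.2.2.2.1 h2.2.2.2.2.1 hvw.ne]

lemma gc_lt {V : Type} {G : SimpleGraph V} {A : Finset V} {v w : V} {k : ℕ} (hk : 3 ≤ k)
    (hv : v ∈ A) (hw : w ∈ A)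
    (hvw : G.Adj v w) (hu : ∀ y ∈ A, G.Adj v y → y = w)
    (hd : dg G (A.erase v) w = 2) (hcard : (A.erase v).card = k + 1) :
    gc G A v k + 1 ≤ ((A.erase v).card - 1).choose (k - 2) := by
  have hwm : w ∈ A.erase v := by simp [hw, hvw.ne.symm]
  set T0 := ((A.erase v).erase w) \ ((A.erase v).filter (G.Adj w)) with hT0
  have hT0m : T0 ∈ ((A.erase v).erase w).powersetCard (k - 2) := by
    rw [Finset.mem_powersetCard]
    refine ⟨Finset.sdiff_subset, ?_⟩
    rw [hT0, Finset.card_sdiff_of_subset, Finset.card_erase_of_mem hwm]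
    · unfold dg at hd; omega
    · intro x hx
      rw [Finset.mem_filter] at hx
      exact Finset.mem_erase.2 ⟨hx.2.ne.symm, hx.1⟩
  rw [← Finset.card_erase_of_mem hwm, ← Finset.card_powersetCard]
  rw [← Finset.card_erase_add_one hT0m]
  apply Nat.succ_le_succ
  apply Finset.card_le_card_of_injOn (fun S => (S.erase v).erase w)
  · intro S hS
    obtain ⟨hSA, hSk, hc, hvS, hwS, hm⟩ := gc_maps hk hvw hu hS
    refine Finset.mem_coe.2 (Finset.mem_erase.2 ⟨?_, hm⟩)
    intro heq
    have := hc.2 {v, w} (by intro x hx; simp at hx; rcases hx with rfl | rfl <;> assumption)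
      ⟨v, by simp⟩ (by
        intro x hx y hy hxy
        simp only [Finset.mem_insert, Finset.mem_singleton] at hx ⊢
        rcases hx with rfl | rfl
        · exact Or.inr (hu y (hSA hy) hxy)
        · by_contra hcon
          push Not at hcon
          have : y ∈ T0 := by
            rw [← heq]; simp [hcon, hy]
          rw [hT0] at this
          simp [hxy, hcon, hSA hy] at this)
    have h2 : ({v, w} : Finset V).card ≤ 2 := Finset.card_le_two
    rw [this] at h2; omega
  · intro S hS S' hS' heq
    have h1 := gc_maps hk hvw hu hS
    have h2 := gc_maps hk hvw hu hS'
    simp only at heq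
    rw [← ins_er h1.2.2.2.1 h1.2.2.2.2.1 hvw.ne, heq, ins_er h2.2.2.2.1 h2.2.2.2.2.1 hvw.ne]

lemma dg_pos {V : Type} {G : SimpleGraph V} {A : Finset V} (h : Cn G A) (hc : 2 ≤ A.card)
    {x : V} (hx : x ∈ A) : 1 ≤ dg G A x := by
  obtain ⟨w, hw, hxw⟩ := h.exists_adj hx hc
  exact Finset.card_pos.2 ⟨w, by simp [hw, hxw]⟩

lemma card_ge {V : Type} {G : SimpleGraph V} {A : Finset V} (h : Cn G A)
    (hs : ∑ x ∈ A, dg G A x = 2 * A.card) : 3 ≤ A.card := by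
  have h1 : ∀ x ∈ A, dg G A x ≤ A.card - 1 := by
    intro x hx
    rw [← Finset.card_erase_of_mem hx]
    apply Finset.card_le_card
    intro y hy
    rw [Finset.mem_filter] at hy
    exact Finset.mem_erase.2 ⟨hy.2.ne.symm, hy.1⟩
  have h2 := Finset.sum_le_card_nsmul A _ _ h1
  rw [hs, smul_eq_mul, mul_comm] at h2
  have := Nat.le_of_mul_le_mul_left h2 (Finset.card_pos.2 h.1)
  omega

lemma reg_of_no_leaf {V : Type} {G : SimpleGraph V} {A : Finset V} (h : Cn G A)
    (hs : ∑ x ∈ A, dg G A x = 2 * A.card) (hno : ∀ x ∈ A, dg G A x ≠ 1) :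
    ∀ x ∈ A, dg G A x = 2 := by
  have h3 := card_ge h hs
  have hge : ∀ x ∈ A, 2 ≤ dg G A x := by
    intro x hx
    have := dg_pos h (by omega) hx
    have := hno x hx
    omega
  have := (Finset.sum_eq_sum_iff_of_le hge).1 (by rw [hs]; simp [mul_comm])
  intro x hx; exact (this x hx).symm

lemma sum_erase_leaf {V : Type} {G : SimpleGraph V} {A : Finset V} {v : V}
    (hv : v ∈ A) (hd : dg G A v = 1) (hs : ∑ x ∈ A, dg G A x = 2 * A.card) :
    ∑ x ∈ A.erase v, dg G (A.erase v) x = 2 * (A.erase v).card := by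
  have h1 : ∀ x ∈ A.erase v, dg G A x = dg G (A.erase v) x + if G.Adj v x then 1 else 0 := by
    intro x hx
    unfold dg
    conv_lhs => rw [← Finset.insert_erase hv, Finset.filter_insert]
    rw [G.adj_comm v x]
    split_ifs with hh
    · rw [Finset.card_insert_of_notMem (by simp)]
    · rfl
  rw [← Finset.add_sum_erase _ _ hv, Finset.sum_congr rfl h1, Finset.sum_add_distrib,
    ← Finset.card_filter] at hs
  have h2 : ((A.erase v).filter (G.Adj v)).card = 1 := by
    rw [← hd]; unfold dg
    congr 1
    ext y
    simp only [Finset.mem_filter, Finset.mem_erase]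
    constructor
    · tauto
    · rintro ⟨a, b⟩; exact ⟨⟨b.ne.symm, a⟩, b⟩
  rw [h2, hd] at hs
  have := Finset.card_erase_add_one hv
  omega

lemma main_ind {V : Type} {G : SimpleGraph V} {k : ℕ} (hk : 3 ≤ k) :
    ∀ (m : ℕ) (A : Finset V), A.card = m + 1 → Cn G A → ∑ x ∈ A, dg G A x = 2 * A.card →
      (∃ v ∈ A, dg G A v = 1) → fc G A k ≤ m.choose (k - 1) := by
  intro m
  induction m with
  | zero => intro A hA hc hs _; have := card_ge hc hs; omega
  | succ m ih =>
    rintro A hA hc hs ⟨v, hv, hd⟩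
    obtain ⟨w, hw, hvw, hu⟩ := dg_one hd
    have hH := hc.erase_leaf hv hw hvw hu
    have hsH := sum_erase_leaf hv hd hs
    have hcard : (A.erase v).card = m + 1 := by rw [Finset.card_erase_of_mem hv]; omega
    have h3 := card_ge hH hsH
    have hg := gc_le hk hv hw hvw hu
    rw [fc_split G A v]
    obtain ⟨j, rfl⟩ : ∃ j, k = j + 2 := ⟨k - 2, by omega⟩
    have e1 : j + 2 - 2 = j := by omega
    have e2 : j + 2 - 1 = j + 1 := by omega
    simp only [e1, e2] at *
    rw [Nat.choose_succ_succ']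
    rw [hcard, Nat.add_sub_cancel] at hg
    by_cases hl : ∃ v' ∈ A.erase v, dg G (A.erase v) v' = 1
    · have := ih _ hcard hH hsH hl
      omega
    push Not at hl
    have hreg := reg_of_no_leaf hH hsH hl
    have hf := fc_le_choose G (A.erase v) (j + 2)
    rw [hcard] at hf
    rcases lt_trichotomy (j + 2) m with h | h | h
    · have h4 := fc_cycle (k := j + 2) hH hreg (by omega)
      have h5 := choose_bound m (j + 1) (by omega) (by omega)
      omega
    · have hg' := gc_lt hk hv hw hvw hu (hreg w (by simp [hw, hvw.ne.symm])) (by omega)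
      rw [hcard, Nat.add_sub_cancel, Nat.add_sub_cancel] at hg'
      subst h
      rw [Nat.choose_succ_self_right] at hf
      have : (j + 2).choose (j + 1) = j + 2 := Nat.choose_succ_self_right (j + 1)
      omega
    · rcases Nat.lt_or_ge (m + 1) (j + 2) with h6 | h6
      · rw [Nat.choose_eq_zero_of_lt h6] at hf
        omega
      · have : m = j + 1 := by omega
        subst this
        rw [Nat.choose_self] at hf ⊢
        omega

lemma dg_univ {V : Type} [Fintype V] (G : SimpleGraph V) (x : V) :
    dg G Finset.univ x = G.degree x := by
  unfold dg
  rw [← SimpleGraph.card_neighborFinset_eq_degree]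
  congr 1
  ext y; simp

lemma iso_cycle (n : ℕ) (hn : 3 ≤ n) (G : SimpleGraph (Fin n)) (hconn : G.Connected)
    (hreg : ∀ x, G.degree x = 2) : Nonempty (G ≃g SimpleGraph.cycleGraph n) := by
  obtain ⟨m, rfl⟩ : ∃ m, n = m + 3 := ⟨n - 3, by omega⟩
  have hcyc : G.IsCycles := by
    intro v _
    rw [← hreg v, ← SimpleGraph.card_neighborSet_eq_degree, Set.ncard_eq_toFinset_card',
      Set.toFinset_card]
  obtain ⟨p, hp, hverts⟩ := hcyc.exists_cycle_toSubgraph_verts_eq_connectedComponentSupp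
    (v := (0 : Fin (m + 3))) (c := G.connectedComponentMk 0) (by simp) (by
      rw [← Set.ncard_pos, Set.ncard_eq_toFinset_card', Set.toFinset_card,
        SimpleGraph.card_neighborSet_eq_degree, hreg]; omega)
  have hall : ∀ x, x ∈ p.support := by
    intro x
    rw [← SimpleGraph.Walk.mem_verts_toSubgraph, hverts, SimpleGraph.ConnectedComponent.mem_supp_iff,
      SimpleGraph.ConnectedComponent.eq]
    exact hconn.preconnected x 0
  have h3 := hp.three_le_length
  have hinj := hp.getVert_injOn'
  let F : Fin p.length → Fin (m + 3) := fun i => p.getVert i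
  have hFi : Function.Injective F := by
    intro i j hij
    exact Fin.ext (hinj (by simp; omega) (by simp; omega) hij)
  have hFs : Function.Surjective F := by
    intro x
    obtain ⟨i, hi, hle⟩ := SimpleGraph.Walk.mem_support_iff_exists_getVert.1 (hall x)
    by_cases hil : i = p.length
    · refine ⟨⟨0, by omega⟩, ?_⟩
      subst hil
      simp [F] at hi ⊢
      exact hi
    · exact ⟨⟨i, by omega⟩, hi⟩
  have hlen : p.length = m + 3 := by
    simpa using Fintype.card_of_bijective (f := F) ⟨hFi, hFs⟩
  let f : Fin (m + 3) → Fin (m + 3) := fun i => p.getVert i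
  have hfi : Function.Injective f := by
    intro i j hij
    exact Fin.ext (hinj (by simp; omega) (by simp; omega) hij)
  have hfb : Function.Bijective f := Finite.injective_iff_bijective.1 hfi
  have hsucc : ∀ i : Fin (m + 3), G.Adj (f i) (f (i + 1)) := by
    intro i
    have h := p.adj_getVert_succ (i := i) (by omega)
    by_cases hl : i = Fin.last (m + 2)
    · subst hl
      have h0 : p.getVert (m + 2 + 1) = 0 := by
        have := p.getVert_length
        rwa [hlen] at this
      simp only [f, Fin.last_add_one, Fin.val_last, Fin.val_zero, SimpleGraph.Walk.getVert_zero] at h ⊢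
      rwa [h0] at h
    · have : ((i + 1 : Fin (m + 3)) : ℕ) = i + 1 := Fin.val_add_one_of_lt (Fin.lt_last_iff_ne_last.2 hl)
      simp only [f, this]
      exact h
  have hfwd : ∀ i j, (cycleGraph (m + 3)).Adj i j → G.Adj (f i) (f j) := by
    intro i j hij
    rw [SimpleGraph.cycleGraph_adj] at hij
    rcases hij with h | h
    · have : i = j + 1 := by rw [← h]; abel
      rw [this]; exact (hsucc j).symm
    · have : j = i + 1 := by rw [← h]; abel
      rw [this]; exact hsucc i
  have hiff : ∀ i j, G.Adj (f i) (f j) ↔ (cycleGraph (m + 3)).Adj i j := by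
    intro i j
    refine ⟨fun h => ?_, hfwd i j⟩
    have hsub : ((cycleGraph (m + 3)).neighborFinset i).image f ⊆ G.neighborFinset (f i) := by
      intro y hy
      obtain ⟨z, hz, rfl⟩ := Finset.mem_image.1 hy
      rw [SimpleGraph.mem_neighborFinset] at hz ⊢
      exact hfwd i z hz
    have heq := Finset.eq_of_subset_of_card_le hsub (by
      rw [Finset.card_image_of_injective _ hfi, SimpleGraph.card_neighborFinset_eq_degree,
        SimpleGraph.card_neighborFinset_eq_degree, hreg, ← @SimpleGraph.cycleGraph_degree_three_le m i])
    have hm : f j ∈ G.neighborFinset (f i) := by simpa using h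
    rw [← heq] at hm
    obtain ⟨z, hz, hzj⟩ := Finset.mem_image.1 hm
    rw [← hfi hzj]; simpa using hz
  exact ⟨(⟨Equiv.ofBijective f hfb, fun {a b} => hiff a b⟩ : cycleGraph (m + 3) ≃g G).symm⟩

lemma Cn_of_center {V : Type} {G : SimpleGraph V} {S : Finset V} {c : V} (hc : c ∈ S)
    (h : ∀ x ∈ S, x ≠ c → G.Adj c x) : Cn G S := by
  refine ⟨⟨c, hc⟩, ?_⟩
  rintro T hT ⟨t, ht⟩ hcl
  have hcT : c ∈ T := by
    by_cases htc : t = c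
    · rwa [← htc]
    · exact hcl t ht c hc (h t (hT ht) htc).symm
  apply Finset.Subset.antisymm hT
  intro y hy
  by_cases hyc : y = c
  · rwa [hyc]
  · exact hcl c hcT y hy (h y hy hyc)

lemma U_adj {n : ℕ} {a b : Fin n} (ha : a.val = 0) (h : b ≠ a) : (Ugraph n).Adj a b := by
  unfold Ugraph
  rw [SimpleGraph.fromRel_adj]
  exact ⟨h.symm, Or.inl (Or.inl ha)⟩

lemma star_card (n k : ℕ) (z : Fin n) :
    (((univ : Finset (Fin n)).erase z).powersetCard k).image (insert z) ⊆
      (univ : Finset (Fin n)).powersetCard (k + 1) ∧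
    ((((univ : Finset (Fin n)).erase z).powersetCard k).image (insert z)).card
      = (n - 1).choose k := by
  constructor
  · intro S hS
    obtain ⟨T, hT, rfl⟩ := Finset.mem_image.1 hS
    rw [Finset.mem_powersetCard, Finset.subset_erase] at hT
    rw [Finset.mem_powersetCard]
    exact ⟨Finset.subset_univ _, by rw [Finset.card_insert_of_notMem hT.1.2, hT.2]⟩
  · rw [Finset.card_image_of_injOn]
    · simp
    · intro S hS T hT heq
      simp only [Finset.mem_coe, Finset.mem_powersetCard, Finset.subset_erase] at hS hT
      rw [← Finset.erase_insert hS.1.2, ← Finset.erase_insert hT.1.2]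
      exact congrArg (fun X => X.erase z) heq

lemma U_star_sub (n k : ℕ) (z : Fin n) (hz : z.val = 0) :
    (((univ : Finset (Fin n)).erase z).powersetCard k).image (insert z) ⊆
      ((univ : Finset (Fin n)).powersetCard (k + 1)).filter (Cn (Ugraph n)) := by
  intro S hS
  refine Finset.mem_filter.2 ⟨(star_card n k z).1 hS, ?_⟩
  obtain ⟨T, hT, rfl⟩ := Finset.mem_image.1 hS
  exact Cn_of_center (c := z) (by simp) (fun x _ hx => U_adj hz hx)

lemma U_lower (n k : ℕ) (hn : 5 ≤ n) : (n - 1).choose k ≤ fc (Ugraph n) univ (k + 1) := by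
  rw [← (star_card n k ⟨0, by omega⟩).2]
  exact Finset.card_le_card (U_star_sub n k _ rfl)

lemma U_two (n : ℕ) (hn : 5 ≤ n) : n ≤ fc (Ugraph n) univ 2 := by
  have h := (star_card n 1 ⟨0, by omega⟩).2
  set B := (((univ : Finset (Fin n)).erase ⟨0, by omega⟩).powersetCard 1).image
    (insert ⟨0, by omega⟩) with hB
  have hne : (⟨1, by omega⟩ : Fin n) ≠ ⟨2, by omega⟩ := by simp
  have hnot : ({⟨1, by omega⟩, ⟨2, by omega⟩} : Finset (Fin n)) ∉ B := by
    intro hh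
    obtain ⟨T, hT, heq⟩ := Finset.mem_image.1 hh
    have : (⟨0, by omega⟩ : Fin n) ∈ ({⟨1, by omega⟩, ⟨2, by omega⟩} : Finset (Fin n)) := by
      rw [← heq]; simp
    simp at this
  have hsub : insert ({⟨1, by omega⟩, ⟨2, by omega⟩} : Finset (Fin n)) B ⊆
      ((univ : Finset (Fin n)).powersetCard 2).filter (Cn (Ugraph n)) := by
    intro S hS
    rcases Finset.mem_insert.1 hS with rfl | hS
    · rw [Finset.mem_filter, Finset.mem_powersetCard]
      refine ⟨⟨Finset.subset_univ _, Finset.card_pair hne⟩, ?_⟩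
      refine Cn_of_center (c := ⟨1, by omega⟩) (by simp) ?_
      intro x hx hx1
      simp only [Finset.mem_insert, Finset.mem_singleton] at hx
      have := hx.resolve_left hx1
      subst this
      unfold Ugraph
      rw [SimpleGraph.fromRel_adj]
      exact ⟨hne, Or.inl (Or.inr ⟨rfl, rfl⟩)⟩
    · exact U_star_sub n 1 _ rfl hS
  have := Finset.card_le_card hsub
  rw [Finset.card_insert_of_notMem hnot, h, Nat.choose_one_right] at this
  unfold fc; omega

lemma G_two {V : Type} [Fintype V] (G : SimpleGraph V) :
    fc G univ 2 ≤ G.edgeFinset.card := by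
  refine le_trans (Finset.card_le_card (t := G.edgeFinset.image Sym2.toFinset) ?_)
    Finset.card_image_le
  intro S hS
  rw [Finset.mem_filter, Finset.mem_powersetCard] at hS
  obtain ⟨⟨_, h2⟩, hc⟩ := hS
  obtain ⟨a, ha⟩ := hc.1
  obtain ⟨b, hb, hab⟩ := hc.exists_adj ha (by omega)
  refine Finset.mem_image.2 ⟨s(a, b), by simpa using hab, ?_⟩
  rw [Sym2.toFinset_mk_eq]
  refine Finset.eq_of_subset_of_card_le ?_ (by rw [h2, Finset.card_pair hab.ne])
  intro x hx
  simp at hx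
  rcases hx with rfl | rfl <;> assumption

lemma main_aux (n : ℕ) (hn : 5 ≤ n) (G : SimpleGraph (Fin n))
    (hconn : G.Connected) (hedges : G.edgeSet.ncard = n)
    (hniso : ¬ Nonempty (G ≃g SimpleGraph.cycleGraph n)) (k : ℕ) (hk : 1 ≤ k) :
    fc G univ k ≤ fc (Ugraph n) univ k := by
  have hE : G.edgeFinset.card = n := by
    refine Eq.trans ?_ hedges
    rw [Set.ncard_eq_toFinset_card']
    rfl
  obtain rfl | rfl | hk3 : k = 1 ∨ k = 2 ∨ 3 ≤ k := by omega
  · apply Finset.card_le_card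
    intro S hS
    rw [Finset.mem_filter] at hS ⊢
    refine ⟨hS.1, ?_⟩
    obtain ⟨a, rfl⟩ := Finset.card_eq_one.1 (Finset.mem_powersetCard.1 hS.1).2
    exact Cn_of_center (c := a) (by simp) (by simp)
  · have := G_two G
    have := U_two n hn
    omega
  · have hc : Cn G univ := by
      rw [← Cn_iff]
      rw [Finset.coe_univ]
      exact (SimpleGraph.induceUnivIso G).connected_iff.2 hconn
    have hs : ∑ x ∈ univ, dg G univ x = 2 * (univ : Finset (Fin n)).card := by
      simp only [dg_univ]
      rw [SimpleGraph.sum_degrees_eq_twice_card_edges, hE]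
      simp
    have hleaf : ∃ v ∈ (univ : Finset (Fin n)), dg G univ v = 1 := by
      by_contra hcon
      push Not at hcon
      have hreg := reg_of_no_leaf hc hs hcon
      exact hniso (iso_cycle n (by omega) G hconn (fun x => by
        rw [← dg_univ]; exact hreg x (by simp)))
    have h1 := main_ind hk3 (n - 1) univ (by simp; omega) hc hs hleaf
    have h2 := U_lower n (k - 1) hn
    rw [Nat.sub_add_cancel hk] at h2
    exact h1.trans h2

end aux

/-- If `G` is a unicyclic graph of order `n ≥ 5` not isomorphic to the cycle `C_n`, then
`S_k(G) ≤ S_k(U_n)` for every `k ≥ 1`, i.e. `CS(G,x) ⪯ CS(U_n,x)` coefficientwise. -/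
theorem connCount_le_Ugraph (n : ℕ) (hn : 5 ≤ n) (G : SimpleGraph (Fin n))
    (hconn : G.Connected) (hedges : G.edgeSet.ncard = n)
    (hniso : ¬ Nonempty (G ≃g SimpleGraph.cycleGraph n)) :
    ∀ k, 1 ≤ k → connCount G k ≤ connCount (Ugraph n) k := by
  intro k hk
  rw [connCount_eq, connCount_eq]
  exact main_aux n hn G hconn hedges hniso k hk
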